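/- arXiv:2403.05214 — 2 statements merged into one kernel-verified Lean document; each statement's English description precedes it below -/
import Mathlib

section
/- Let M ∈ ℂ^{n×n} be an idempotent matrix of rank r, let s = n − r and t = rank(M) − dim(null(I − MM^H)). Then there exist angles π/2 > ψ₁ ≥ ⋯ ≥ ψ_t > 0, a unitary matrix 𝒰 ∈ ℂ^{n×n}, and a real orthogonal matrix O ∈ ℝ^{n×n} of the form O = [[C, 0, ES],[0, I_{n−2t}, 0],[S, 0, −EC]] with C = diag(cos ψ₁, …, cos ψ_t), S = diag(sin ψ₁, …, sin ψ_t) and E = diag(±1, …, ±1) ∈ ℝ^{t×t}, such that M = 𝒰𝒮(𝒰O)^H, where 𝒮 = diag(C^{−1}, I_{r−t}, 0_{s−t}, 0_t). In particular, M has a singular value decomposition M = 𝒰𝒮𝒱^H in which the right singular vector matrix satisfies 𝒱 = 𝒰O with O real orthogonal. -/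
open Matrix

/-- The diagonal matrix `𝒮 = diag(C⁻¹, I_{r-t}, 0_{s-t}, 0_t)` with
`C = diag(cos ψ₁, …, cos ψ_t)`. -/
noncomputable def Smat (n r t : ℕ) (ψ : ℕ → ℝ) : Matrix (Fin n) (Fin n) ℝ :=
  Matrix.of fun i j =>
    if (i : ℕ) = (j : ℕ) then
      (if (i : ℕ) < t then (Real.cos (ψ (i : ℕ)))⁻¹ else if (i : ℕ) < r then 1 else 0)
    else 0

/-- The real matrix `O = [[C,0,ES],[0,I_{n-2t},0],[S,0,-EC]]` where the first `t` and
last `t` rows/columns carry the nontrivial blocks, `C = diag(cos ψ_j)`,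
`S = diag(sin ψ_j)` and `E = diag(±1)`. -/
noncomputable def Omat (n t : ℕ) (ψ E : ℕ → ℝ) : Matrix (Fin n) (Fin n) ℝ :=
  Matrix.of fun i j =>
    if (i : ℕ) < t then
      (if (j : ℕ) = (i : ℕ) then Real.cos (ψ (i : ℕ))
       else if (j : ℕ) = n - t + (i : ℕ) then E (i : ℕ) * Real.sin (ψ (i : ℕ))
       else 0)
    else if (i : ℕ) < n - t then (if (j : ℕ) = (i : ℕ) then 1 else 0)
    else
      (if (j : ℕ) = (i : ℕ) - (n - t) then Real.sin (ψ ((i : ℕ) - (n - t)))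
       else if (j : ℕ) = (i : ℕ) then -(E ((i : ℕ) - (n - t)) * Real.cos (ψ ((i : ℕ) - (n - t))))
       else 0)

/-- The dimension of the null space of `I - M Mᴴ`. -/
noncomputable def nullityOneSubMMH {n : ℕ} (M : Matrix (Fin n) (Fin n) ℂ) : ℕ :=
  Module.finrank ℂ (LinearMap.ker (Matrix.mulVecLin (1 - M * Mᴴ)))

lemma aux_count {n m : ℕ} (P : Fin n → Prop) [DecidablePred P]
    (hP : ∀ i j, i ≤ j → P j → P i) (hm : (Finset.univ.filter P).card = m) (i : Fin n) :
    P i ↔ (i : ℕ) < m := by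
  constructor
  · intro h
    have : Finset.Iic i ⊆ Finset.univ.filter P := by
      intro j hj
      simp only [Finset.mem_Iic] at hj
      simp [hP j i hj h]
    have := Finset.card_le_card this
    simp at this
    omega
  · intro h
    by_contra hn
    have : Finset.univ.filter P ⊆ Finset.Iio i := by
      intro j hj
      simp only [Finset.mem_filter, Finset.mem_univ, true_and] at hj
      simp only [Finset.mem_Iio]
      by_contra hc
      exact hn (hP i j (not_lt.mp hc) hj)
    have := Finset.card_le_card this
    simp at this
    omega

lemma aux_key {E : Type*} [NormedAddCommGroup E] [InnerProductSpace ℂ E] [FiniteDimensional ℂ E]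
    {n r t : ℕ} (T T' : E →ₗ[ℂ] E) (hn : Module.finrank ℂ E = n)
    (hT : ∀ x, T (T x) = T x) (hadj : ∀ x y, inner ℂ (T x) y = inner ℂ x (T' y))
    (hr : r + Module.finrank ℂ (Module.End.eigenspace (T ∘ₗ T') 0) = n)
    (ht : t = r - Module.finrank ℂ (Module.End.eigenspace (T ∘ₗ T') 1)) :
    ∃ (b : OrthonormalBasis (Fin n) ℂ E) (τ : ℕ → ℝ), r + t ≤ n ∧ t ≤ r ∧
      (∀ k, k + 1 < t → τ (k + 1) ≤ τ k) ∧ (∀ k, k < t → 0 < τ k) ∧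
      (∀ i : Fin n, (i : ℕ) < r → T (b i) = b i) ∧
      (∀ i : Fin n, r ≤ (i : ℕ) → (i : ℕ) < n - t → T (b i) = 0) ∧
      (∀ i j : Fin n, (i : ℕ) < t → (j : ℕ) = n - t + i → T (b j) = (τ i : ℂ) • b i) := by
  classical
  have hadj' : ∀ x y, inner ℂ (T' x) y = inner ℂ x (T y) := fun x y => by
    rw [← inner_conj_symm, ← hadj, inner_conj_symm]
  have hS : (T ∘ₗ T').IsSymmetric := fun x y => by
    simp only [LinearMap.comp_apply]
    rw [hadj, hadj']
  set v := hS.eigenvectorBasis hn with hv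
  set l := hS.eigenvalues hn with hl
  have hanti : Antitone l := hS.eigenvalues_antitone hn
  have hlv : ∀ i, T (T' (v i)) = (l i : ℂ) • v i := fun i => hS.apply_eigenvectorBasis hn i
  have h0 := hS.card_filter_eigenvalues_eq hn 0
  have h1 := hS.card_filter_eigenvalues_eq hn 1
  rw [← hl] at h0 h1
  have vv : ∀ i j, inner ℂ (v i) (v j) = if i = j then (1 : ℂ) else 0 :=
    fun i j => orthonormal_iff_ite.mp v.orthonormal i j
  have hfix : ∀ i, l i ≠ 0 → T (v i) = v i := by
    intro i hi
    have hi' : (l i : ℂ) ≠ 0 := by exact_mod_cast hi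
    have : v i = (l i : ℂ)⁻¹ • T (T' (v i)) := by rw [hlv, smul_smul, inv_mul_cancel₀ hi', one_smul]
    rw [this, map_smul, hT]
  have hvc : ∀ i j, l i ≠ 0 → inner ℂ (v i) (T' (v j) - v j) = 0 := by
    intro i j hi
    rw [inner_sub_right, ← hadj, hfix i hi, sub_self]
  have hcc : ∀ i j, l i ≠ 0 → l j ≠ 0 → inner ℂ (T' (v i) - v i) (T' (v j) - v j) =
      if i = j then ((l i - 1 : ℝ) : ℂ) else 0 := by
    intro i j hi hj
    rw [inner_sub_left, hvc i j hi, sub_zero, inner_sub_right, hadj', hlv, hadj', hfix j hj,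
      inner_smul_right, vv]
    split_ifs with h
    · subst h; push_cast; ring
    · ring
  have hdich : ∀ i, l i = 0 ∨ 1 ≤ l i := by
    intro i
    by_cases hi : l i = 0
    · exact Or.inl hi
    right
    have := hcc i i hi hi
    rw [if_pos rfl, inner_self_eq_norm_sq_to_K] at this
    have h2 : ‖T' (v i) - v i‖ ^ 2 = l i - 1 := by
      apply Complex.ofReal_injective
      rw [← this]
      push_cast
      rfl
    nlinarith [sq_nonneg ‖T' (v i) - v i‖]
  have hir : ∀ i, l i ≠ 0 ↔ (i : ℕ) < r := by
    have hh : ∀ i, l i ≠ 0 ↔ 0 < l i := fun i => by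
      rcases hdich i with h | h
      · simp [h]
      · constructor <;> intro _ <;> [linarith; exact (by linarith : (0:ℝ) < l i).ne']
    apply aux_count
    · intro i j hij hj
      rw [hh] at *
      exact hj.trans_le (hanti hij)
    · have := Finset.card_filter_add_card_filter_not (s := (Finset.univ : Finset (Fin n))) (fun i => l i = 0)
      simp at this
      simp at h0
      simp
      omega
  have hit : ∀ i, 1 < l i ↔ (i : ℕ) < t := by
    apply aux_count
    · intro i j hij hj
      exact hj.trans_le (hanti hij)
    · have e1 := Finset.card_filter_add_card_filter_not (s := (Finset.univ : Finset (Fin n))) (fun i => l i = 0)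
      have e2 : (Finset.univ.filter (fun i => ¬ l i = 0)) = (Finset.univ.filter (fun i => l i = 1)) ∪ (Finset.univ.filter (fun i => 1 < l i)) := by
        ext i
        simp
        rcases hdich i with h | h
        · simp [h]
        · constructor
          · intro _
            rcases h.eq_or_lt with h | h <;> simp [h]
          · intro _ h'
            linarith
      rw [e2, Finset.card_union_of_disjoint] at e1
      · simp at e1 h0
        have h1' : (Finset.univ.filter (fun i => l i = 1)).card = Module.finrank ℂ (Module.End.eigenspace (T ∘ₗ T') 1) := by
          rw [← h1]; congr 1; ext i; simp
        omega
      · rw [Finset.disjoint_filter]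
        intro i _ h h'
        linarith
  have htr : t ≤ r := by omega
  have hrn : r ≤ n := by omega
  set τ : ℕ → ℝ := fun k => if h : k < n then Real.sqrt (l ⟨k, h⟩ - 1) else 0 with hτ
  have hτ' : ∀ i : Fin n, τ i = Real.sqrt (l i - 1) := fun i => by simp [hτ]
  have hτpos : ∀ k, k < t → 0 < τ k := by
    intro k hk
    have hkn : k < n := by omega
    have := (hit ⟨k, hkn⟩).2 hk
    rw [show τ k = _ from hτ' ⟨k, hkn⟩]
    exact Real.sqrt_pos.2 (by linarith)
  have hτsq : ∀ i : Fin n, (i : ℕ) < t → l i - 1 = τ i ^ 2 := by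
    intro i hi
    rw [hτ', Real.sq_sqrt]
    linarith [(hit i).2 hi]
  let G : Fin r ⊕ Fin t → E := Sum.elim (fun i => v ⟨i, by omega⟩)
    (fun k => ((τ k : ℂ)⁻¹) • (T' (v ⟨k, by omega⟩) - v ⟨k, by omega⟩))
  have hG : Orthonormal ℂ G := by
    rw [orthonormal_iff_ite]
    rintro (i | i) (j | j)
    · simp [G, vv, Fin.ext_iff]
    · simp only [G, Sum.elim_inl, Sum.elim_inr, reduceCtorEq, if_false]
      rw [inner_smul_right, hvc _ _ ((hir _).2 i.2), mul_zero]
    · simp only [G, Sum.elim_inl, Sum.elim_inr, reduceCtorEq, if_false]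
      rw [inner_smul_left, ← inner_conj_symm, hvc _ _ ((hir _).2 j.2), map_zero, mul_zero]
    · simp only [G, Sum.elim_inr, Sum.inr.injEq]
      have hi' : (i : ℕ) < r := by omega
      have hj' : (j : ℕ) < r := by omega
      rw [inner_smul_right, inner_smul_left, hcc _ _ ((hir _).2 hi') ((hir _).2 hj')]
      by_cases h : i = j
      · subst h
        have hp := hτpos i i.2
        have hp' : (τ i : ℂ) ≠ 0 := by exact_mod_cast hp.ne'
        rw [if_pos rfl, if_pos rfl, hτsq _ (by exact i.2)]
        simp
        field_simp
      · simp [h, Fin.ext_iff]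
        intro h'
        exact absurd (Fin.ext h') h
  have hcard : r + t ≤ n := by
    have := hG.linearIndependent.fintype_card_le_finrank
    simpa [hn] using this
  let s : Set (Fin n) := {i | (i : ℕ) < r ∨ n - t ≤ i}
  let g : s → Fin r ⊕ Fin t := fun i => if h : (i : ℕ) < r then Sum.inl ⟨i, h⟩ else
    Sum.inr ⟨(i : ℕ) - (n - t), by have := i.1.2; have := i.2; simp only [s, Set.mem_ofPred_eq] at this; omega⟩
  have hg : Function.Injective g := by
    rintro ⟨i, hi⟩ ⟨j, hj⟩ h
    simp only [s, Set.mem_ofPred_eq] at hi hj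
    simp only [g] at h
    rw [Subtype.mk.injEq, Fin.ext_iff]
    split_ifs at h <;> simp at h <;> omega
  let f : Fin n → E := fun i => if h : i ∈ s then G (g ⟨i, h⟩) else 0
  have hf : Orthonormal ℂ (s.domRestrict f) := by
    have : s.domRestrict f = G ∘ g := by
      ext i
      simp [f]
    rw [this]
    exact hG.comp g hg
  obtain ⟨b, hb⟩ := hf.exists_orthonormalBasis_extension_of_card_eq (by simp [hn])
  have hb1 : ∀ i : Fin n, (i : ℕ) < r → b i = v i := by
    intro i hi
    have his : i ∈ s := Or.inl hi
    rw [hb i his]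
    simp [f, his, g, hi, G]
  have hb2 : ∀ i j : Fin n, (i : ℕ) < t → (j : ℕ) = n - t + i →
      b j = (τ i : ℂ)⁻¹ • (T' (v i) - v i) := by
    intro i j hi hj
    have his : j ∈ s := Or.inr (by omega)
    have hjr : ¬ (j : ℕ) < r := by omega
    rw [hb j his]
    simp only [f, his, g, hjr, G, dif_pos, dif_neg, not_false_eq_true, Sum.elim_inr]
    simp [hj]
  refine ⟨b, τ, hcard, htr, ?_, hτpos, ?_, ?_, ?_⟩
  · intro k hk
    have h1 : k + 1 < n := by omega
    have h2 : k < n := by omega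
    rw [show τ (k+1) = _ from hτ' ⟨k+1, h1⟩, show τ k = _ from hτ' ⟨k, h2⟩]
    apply Real.sqrt_le_sqrt
    have := hanti (show (⟨k, h2⟩ : Fin n) ≤ ⟨k+1, h1⟩ by simp)
    linarith
  · intro i hi
    rw [hb1 i hi, hfix i ((hir i).2 hi)]
  · intro i hi1 hi2
    apply InnerProductSpace.ext_inner_left_basis (𝕜 := ℂ) v.toBasis
    intro j
    rw [OrthonormalBasis.coe_toBasis, inner_zero_right, ← hadj']
    by_cases hj : l j = 0
    · have : T' (v j) = 0 := by
        rw [← inner_self_eq_zero (𝕜 := ℂ), hadj', hlv, hj]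
        simp
      rw [this, inner_zero_left]
    · have hjr := (hir j).1 hj
      have hbi : inner ℂ (v j) (b i) = 0 := by
        rw [← hb1 j hjr]
        apply b.orthonormal.2
        rintro rfl
        omega
      have : inner ℂ (T' (v j) - v j) (b i) = 0 := by
        by_cases hjt : (j : ℕ) < t
        · have hp' : (τ j : ℂ) ≠ 0 := by exact_mod_cast (hτpos j hjt).ne'
          have e := hb2 j ⟨n - t + j, by omega⟩ hjt rfl
          have e2 : T' (v j) - v j = (τ j : ℂ) • b ⟨n - t + j, by omega⟩ := by
            rw [e, smul_smul, mul_inv_cancel₀ hp', one_smul]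
          rw [e2, inner_smul_left, b.orthonormal.2, mul_zero]
          intro h
          rw [Fin.ext_iff] at h
          simp at h
          omega
        · have hl1 : l j = 1 := by
            rcases hdich j with h | h
            · exact absurd h hj
            · exact le_antisymm (not_lt.1 (fun h => hjt ((hit j).1 h))) h
          have : T' (v j) - v j = 0 := by
            rw [← inner_self_eq_zero (𝕜 := ℂ), hcc j j hj hj, hl1]
            simp
          rw [this, inner_zero_left]
      rw [inner_sub_left, hbi, sub_zero] at this
      exact this
  · intro i j hi hj
    have hir' : (i : ℕ) < r := by omega
    rw [hb2 i j hi hj, hb1 i hir', map_smul, map_sub, hlv, hfix i ((hir i).2 hir')]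
    have hp' : (τ i : ℂ) ≠ 0 := by exact_mod_cast (hτpos i hi).ne'
    have e : (l i : ℂ) = 1 + (τ i : ℂ) ^ 2 := by
      have := hτsq i hi
      rw [show l i = 1 + τ i ^ 2 by linarith]
      push_cast; rfl
    rw [e, add_smul, one_smul, add_sub_cancel_left, smul_smul]
    congr 1
    field_simp

open scoped ComplexOrder in
lemma aux_rank {n : ℕ} (M : Matrix (Fin n) (Fin n) ℂ) : (M * Mᴴ).rank = M.rank :=
  Matrix.rank_self_mul_conjTranspose M

lemma aux_Omat_mulVec {K : Type*} [Field K] (f : ℝ →+* K) {n t : ℕ} (h2 : t + t ≤ n) (ψ : ℕ → ℝ)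
    (x : Fin n → K) (i : Fin n) :
    (((Omat n t ψ (fun _ => 1)).map f) *ᵥ x) i =
      if h : (i : ℕ) < t then f (Real.cos (ψ i)) * x i + f (Real.sin (ψ i)) * x ⟨n - t + i, by omega⟩
      else if h' : (i : ℕ) < n - t then x i
      else f (Real.sin (ψ ((i : ℕ) - (n - t)))) * x ⟨(i : ℕ) - (n - t), by omega⟩
        - f (Real.cos (ψ ((i : ℕ) - (n - t)))) * x i := by
  have hin := i.2
  simp only [Matrix.mulVec, dotProduct, Matrix.map_apply, Omat, Matrix.of_apply]
  split_ifs with h h'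
  · have hne : i ≠ ⟨n - t + i, by omega⟩ := by
      intro hh; rw [Fin.ext_iff] at hh; simp at hh; omega
    rw [Finset.sum_eq_add_of_mem i ⟨n - t + i, by omega⟩ (Finset.mem_univ _) (Finset.mem_univ _) hne]
    · have : ¬ (n - t = 0) := by omega
      simp [this]
    · rintro c - ⟨h1, h2⟩
      rw [Ne, Fin.ext_iff] at h1 h2
      simp at h1 h2
      simp [h1, h2]
  · rw [Finset.sum_eq_single_of_mem i (Finset.mem_univ _)]
    · simp
    · rintro c - h1
      rw [Ne, Fin.ext_iff] at h1
      simp [h1]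
  · have hne : (⟨(i : ℕ) - (n - t), by omega⟩ : Fin n) ≠ i := by
      intro hh; rw [Fin.ext_iff] at hh; simp at hh; omega
    rw [Finset.sum_eq_add_of_mem ⟨(i : ℕ) - (n - t), by omega⟩ i (Finset.mem_univ _) (Finset.mem_univ _) hne]
    · have : ¬ ((i : ℕ) = i - (n - t)) := by omega
      simp [this, sub_eq_add_neg]
    · rintro c - ⟨h1, h2⟩
      rw [Ne, Fin.ext_iff] at h1 h2
      simp at h1 h2
      simp [h1, h2]

lemma aux_Omat_symm {n t : ℕ} (h2 : t + t ≤ n) (ψ : ℕ → ℝ) :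
    (Omat n t ψ (fun _ => 1))ᵀ = Omat n t ψ (fun _ => 1) := by
  ext i j
  have := i.2
  have := j.2
  simp only [Matrix.transpose_apply, Omat, Matrix.of_apply]
  split_ifs <;> first
    | omega
    | rfl
    | (have : i = j := Fin.ext (by omega)
       subst this
       first | rfl | simp)
    | (rw [show (j : ℕ) - (n - t) = i by omega]; simp; done)
    | (rw [show (i : ℕ) - (n - t) = j by omega]; simp; done)
    | (simp; done)

lemma aux_Omat_sq {n t : ℕ} (h2 : t + t ≤ n) (ψ : ℕ → ℝ) :
    Omat n t ψ (fun _ => 1) * Omat n t ψ (fun _ => 1) = 1 := by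
  apply Matrix.ext_of_mulVec_single
  intro j
  rw [← Matrix.mulVec_mulVec, Matrix.one_mulVec]
  generalize (Pi.single j 1 : Fin n → ℝ) = x
  have key := fun (x : Fin n → ℝ) (i : Fin n) => aux_Omat_mulVec (RingHom.id ℝ) h2 ψ x i
  have e : (Omat n t ψ (fun _ => 1)).map (RingHom.id ℝ) = Omat n t ψ (fun _ => 1) := by ext; rfl
  rw [e] at key
  ext i
  have hin := i.2
  rw [key]
  split_ifs with h h'
  · rw [key, key, dif_pos h, dif_neg (by simp; omega), dif_neg (by simp)]
    simp
    linear_combination (x i) * Real.sin_sq_add_cos_sq (ψ i)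
  · rw [key, dif_neg h, dif_pos h']
  · rw [key, key, dif_neg h, dif_neg h', dif_pos (by simp; omega)]
    have : (⟨n - t + ((i : ℕ) - (n - t)), by omega⟩ : Fin n) = i := by ext; simp; omega
    simp [this]
    linear_combination (x i) * Real.sin_sq_add_cos_sq (ψ (i - (n - t)))

/-- Every idempotent matrix `M` of rank `r` (`s = n - r`,
`t = rank M - dim null(I - M Mᴴ)`) has an SVD `M = 𝒰 𝒮 (𝒰 O)ᴴ` with `𝒰` unitary,
`O` real orthogonal of the form `[[C,0,ES],[0,I_{n-2t},0],[S,0,-EC]]` for angles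
`π/2 > ψ₁ ≥ ⋯ ≥ ψ_t > 0` and signs `E`, and `𝒮 = diag(C⁻¹, I_{r-t}, 0_{s-t}, 0_t)`;
in particular the right singular vector matrix is `𝒱 = 𝒰 O` with `O` real orthogonal. -/
theorem svd_idempotent_structure {n : ℕ}
    (M : Matrix (Fin n) (Fin n) ℂ) (hM : M * M = M)
    (r s t : ℕ) (hr : r = M.rank) (hs : s = n - r)
    (ht : t = M.rank - nullityOneSubMMH M) :
    ∃ (ψ E : ℕ → ℝ) (𝒰 : Matrix (Fin n) (Fin n) ℂ),
      (∀ k, k + 1 < t → ψ (k + 1) ≤ ψ k) ∧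
      (∀ k, k < t → 0 < ψ k ∧ ψ k < Real.pi / 2) ∧
      (∀ k, k < t → E k = 1 ∨ E k = -1) ∧
      𝒰 ∈ Matrix.unitaryGroup (Fin n) ℂ ∧
      Omat n t ψ E ∈ Matrix.orthogonalGroup (Fin n) ℝ ∧
      M = 𝒰 * (Smat n r t ψ).map Complex.ofReal *
            (𝒰 * (Omat n t ψ E).map Complex.ofReal)ᴴ := by
  subst hr
  set T := Matrix.toEuclideanLin M with hTdef
  set T' := Matrix.toEuclideanLin Mᴴ with hT'def
  have hker : ∀ N : Matrix (Fin n) (Fin n) ℂ,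
      Module.finrank ℂ (LinearMap.ker (Matrix.toEuclideanLin N)) =
      Module.finrank ℂ (LinearMap.ker (Matrix.mulVecLin N)) := by
    intro N
    have e : LinearMap.ker (Matrix.mulVecLin N) =
        (LinearMap.ker (Matrix.toEuclideanLin N)).map
          (WithLp.linearEquiv 2 ℂ (Fin n → ℂ)).toLinearMap := by
      ext x
      simp only [Submodule.mem_map, LinearMap.mem_ker]
      constructor
      · intro hx
        refine ⟨WithLp.toLp 2 x, ?_, rfl⟩
        rw [Matrix.toLpLin_toLp]
        exact congrArg (WithLp.toLp 2) hx
      · rintro ⟨y, hy, rfl⟩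
        exact congrArg WithLp.ofLp hy
    rw [e, LinearEquiv.finrank_map_eq]
  have hTT' : T ∘ₗ T' = Matrix.toEuclideanLin (M * Mᴴ) := by
    rw [Matrix.toLpLin_mul_same]
  obtain ⟨b, τ, hrt, htr, hτa, hτp, hb1, hb2, hb3⟩ := aux_key (n := n) (r := M.rank) (t := t) T T'
    (by simp)
    (fun x => by
      have : T ∘ₗ T = T := by rw [hTdef, ← Matrix.toLpLin_mul_same, hM]
      exact LinearMap.congr_fun this x)
    (fun x y => by
      rw [hT'def, Matrix.toEuclideanLin_conjTranspose_eq_adjoint, LinearMap.adjoint_inner_right])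
    (by
      rw [Module.End.eigenspace_zero, hTT', hker, ← aux_rank, Matrix.rank,
        LinearMap.finrank_range_add_finrank_ker]
      simp)
    (by
      rw [ht, nullityOneSubMMH, ← hker]
      have : (Matrix.toEuclideanLin (1 - M * Mᴴ)) = 1 - T ∘ₗ T' := by
        rw [map_sub, Matrix.toLpLin_one, hTT']; rfl
      rw [this]
      suffices hh : LinearMap.ker (1 - T ∘ₗ T') = Module.End.eigenspace (T ∘ₗ T') 1 by rw [hh]
      ext x
      simp only [LinearMap.mem_ker, Module.End.mem_eigenspace_iff, LinearMap.sub_apply, one_smul,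
        Module.End.one_apply, sub_eq_zero]
      exact eq_comm)
  clear_value T T'
  clear hTT'
  have h2 : t + t ≤ n := by omega
  let ψ : ℕ → ℝ := fun k => Real.arctan (τ k)
  have hcos : ∀ k, Real.cos (ψ k) ≠ 0 := fun k => (Real.cos_arctan_pos _).ne'
  let U : Matrix (Fin n) (Fin n) ℂ := (EuclideanSpace.basisFun (Fin n) ℂ).toBasis.toMatrix b
  have hUe : ∀ a j, U a j = b j a := fun a j => by
    simp [U, Module.Basis.toMatrix_apply]
  have hU : U ∈ Matrix.unitaryGroup (Fin n) ℂ :=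
    (EuclideanSpace.basisFun (Fin n) ℂ).toMatrix_orthonormalBasis_mem_unitary b
  have hMU : ∀ a j, (M * U) a j = (T (b j)) a := by
    intro a j
    rw [hTdef]
    simp [Matrix.mul_apply, Matrix.toLpLin_apply, Matrix.mulVec, dotProduct, hUe]
  refine ⟨ψ, fun _ => 1, U, ?_, ?_, fun _ _ => Or.inl rfl, hU, ?_, ?_⟩
  · intro k hk
    exact Real.arctan_strictMono.monotone (hτa k hk)
  · intro k hk
    exact ⟨Real.arctan_pos.2 (hτp k hk), Real.arctan_lt_pi_div_two _⟩
  · rw [Matrix.mem_orthogonalGroup_iff]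
    rw [aux_Omat_symm h2, aux_Omat_sq h2]
  · set O := Omat n t ψ (fun _ => 1) with hO
    have hOs : Oᵀ = O := aux_Omat_symm h2 ψ
    have hOc : (O.map Complex.ofReal)ᴴ = O.map Complex.ofReal := by
      ext i j
      simp only [Matrix.conjTranspose_apply, Matrix.map_apply]
      rw [← Matrix.transpose_apply O, hOs]
      simp
    rw [Matrix.conjTranspose_mul, hOc, ← Matrix.mul_assoc]
    have hUU : U * Uᴴ = 1 := (Matrix.mem_unitaryGroup_iff).1 hU
    suffices h : M * U = U * (Smat n M.rank t ψ).map Complex.ofReal * O.map Complex.ofReal by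
      rw [← h, Matrix.mul_assoc, hUU, Matrix.mul_one]
    let d : Fin n → ℂ := fun i =>
      if (i : ℕ) < t then ((Real.cos (ψ i) : ℝ) : ℂ)⁻¹ else if (i : ℕ) < M.rank then 1 else 0
    have hSd : (Smat n M.rank t ψ).map Complex.ofReal = Matrix.diagonal d := by
      ext i j
      by_cases hij : i = j
      · subst hij
        simp only [Smat, Matrix.map_apply, Matrix.of_apply, if_true, Matrix.diagonal_apply_eq, d]
        split_ifs <;> simp
      · have : ¬ (i : ℕ) = j := fun h => hij (Fin.ext h)
        simp [Smat, Matrix.diagonal_apply_ne _ hij, this]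
    ext a j
    have hj := j.2
    have e : (U * (Smat n M.rank t ψ).map Complex.ofReal * O.map Complex.ofReal) a j =
        ((O.map Complex.ofRealHom) *ᵥ (fun i => U a i * d i)) j := by
      rw [hSd, Matrix.mul_apply]
      simp only [Matrix.mul_diagonal, Matrix.mulVec, dotProduct]
      apply Finset.sum_congr rfl
      intro i _
      rw [mul_comm]
      congr 1
      simp only [Matrix.map_apply]
      rw [← Matrix.transpose_apply O, hOs]
      rfl
    rw [e, hMU, aux_Omat_mulVec Complex.ofRealHom h2]
    split_ifs with hc hc'
    · have h1 : ¬ (n - t + (j : ℕ) < t) := by omega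
      have h3 : ¬ (n - t + (j : ℕ) < M.rank) := by omega
      have h4 : ((Real.cos (ψ j) : ℝ) : ℂ) ≠ 0 := by exact_mod_cast hcos j
      rw [hb1 j (by omega)]
      simp only [d, hc, h1, h3, if_true, if_false, hUe, Complex.ofRealHom_eq_coe]
      field_simp
      simp
    · by_cases hjr : (j : ℕ) < M.rank
      · rw [hb1 j hjr]
        simp [d, hc, hjr, hUe]
      · rw [hb2 j (by omega) hc']
        simp [d, hc, hjr]
    · have h1 : (j : ℕ) - (n - t) < t := by omega
      have h3 : ¬ ((j : ℕ) < M.rank) := by omega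
      have h4 : ((Real.cos (ψ ((j : ℕ) - (n - t))) : ℝ) : ℂ) ≠ 0 := by exact_mod_cast hcos _
      rw [hb3 ⟨(j : ℕ) - (n - t), by omega⟩ j h1 (by simp; omega)]
      simp only [d, hc, h1, h3, if_true, if_false, hUe, Complex.ofRealHom_eq_coe]
      have h5 : τ ((j : ℕ) - (n - t)) = Real.sin (ψ ((j : ℕ) - (n - t))) / Real.cos (ψ ((j : ℕ) - (n - t))) := by
        rw [← Real.tan_eq_sin_div_cos, Real.tan_arctan]
      rw [h5]
      push_cast
      simp [-Complex.ofReal_sin, -Complex.ofReal_cos]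
      ring
end

section
/- Let M ∈ ℂ^{n×n} be idempotent of rank r, s = n − r, ν = min{r, s}, and B = 2M − I. Then B admits a singular value decomposition B = Ũ𝔖Ṽ^H with Ũ, Ṽ ∈ ℂ^{n×n} unitary such that Ṽ = ŨT, where T ∈ ℝ^{n×n} is the real orthogonal involutory matrix T = [[0, 0, I_ν],[0, ±I_{n−2ν}, 0],[I_ν, 0, 0]] (with −I_{n−2ν} if r ≤ s and +I_{n−2ν} if r ≥ s). In particular, the right singular vectors of B are obtained from its left singular vectors by a fixed real signed permutation. -/
open Matrix

/-- The real signed-permutation matrix `T = [[0,0,I_ν],[0, ε I_{n-2ν}, 0],[I_ν,0,0]]`,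
where the first `ν` and last `ν` rows/columns carry the antidiagonal identity blocks
and the middle block is `ε I_{n-2ν}` with `ε = ±1`. -/
noncomputable def Tmat (n ν : ℕ) (ε : ℝ) : Matrix (Fin n) (Fin n) ℝ :=
  Matrix.of fun i j =>
    if (i : ℕ) < ν ∧ (j : ℕ) = n - ν + (i : ℕ) then 1
    else if (j : ℕ) < ν ∧ (i : ℕ) = n - ν + (j : ℕ) then 1
    else if ν ≤ (i : ℕ) ∧ (i : ℕ) < n - ν ∧ (i : ℕ) = (j : ℕ) then ε
    else 0

/-- SVD in the case `s ≤ r`. -/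
lemma svd_aux {E F : Type*} [NormedAddCommGroup E] [InnerProductSpace ℂ E] [FiniteDimensional ℂ E]
    [NormedAddCommGroup F] [InnerProductSpace ℂ F] [FiniteDimensional ℂ F] {r s : ℕ}
    (hE : Module.finrank ℂ E = r) (hF : Module.finrank ℂ F = s) (hsr : s ≤ r) (A : F →ₗ[ℂ] E) :
    ∃ (e : OrthonormalBasis (Fin r) ℂ E) (f : OrthonormalBasis (Fin s) ℂ F) (k : Fin s → ℝ),
      ∀ j : Fin s, A (f j) = (k j : ℂ) • e (Fin.castLE hsr j) := by
  have hS : (LinearMap.adjoint A ∘ₗ A).IsSymmetric := by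
    intro x y
    simp [LinearMap.adjoint_inner_left, LinearMap.adjoint_inner_right]
  let f := hS.eigenvectorBasis hF
  have horth : ∀ i j, i ≠ j → inner ℂ (A (f i)) (A (f j)) = 0 := by
    intro i j hij
    rw [← LinearMap.adjoint_inner_right]
    have h := hS.apply_eigenvectorBasis hF j
    simp only [LinearMap.comp_apply] at h
    rw [show f j = hS.eigenvectorBasis hF j from rfl, h, inner_smul_right]
    have := f.orthonormal.2 hij
    rw [show hS.eigenvectorBasis hF j = f j from rfl, this, mul_zero]
  let v : Fin r → E := fun i => if h : (i : ℕ) < s then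
    ((‖A (f ⟨i, h⟩)‖⁻¹ : ℝ) : ℂ) • A (f ⟨i, h⟩) else 0
  let S : Set (Fin r) := {i | ∃ h : (i : ℕ) < s, A (f ⟨i, h⟩) ≠ 0}
  have hv : Orthonormal ℂ (S.domRestrict v) := by
    constructor
    · rintro ⟨i, hi, hne⟩
      rw [Set.domRestrict_apply]
      simp only [v, hi, dif_pos, norm_smul]
      simp [norm_ne_zero_iff.2 hne]
    · rintro ⟨i, hi, hne⟩ ⟨j, hj, hne'⟩ hij
      have : (⟨i, hi⟩ : Fin s) ≠ ⟨j, hj⟩ := by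
        intro h
        apply hij
        simpa [Fin.ext_iff] using h
      rw [Set.domRestrict_apply, Set.domRestrict_apply]
      simp only [v, hi, hj, dif_pos, inner_smul_left, inner_smul_right,
        horth _ _ this, mul_zero]
  obtain ⟨e, he⟩ := hv.exists_orthonormalBasis_extension_of_card_eq (by simp [hE])
  refine ⟨e, f, fun j => ‖A (f j)‖, fun j => ?_⟩
  by_cases h : A (f j) = 0
  · simp [h]
  · rw [he (Fin.castLE hsr j) ⟨j.2, h⟩]
    have : v (Fin.castLE hsr j) = ((‖A (f j)‖⁻¹ : ℝ) : ℂ) • A (f j) := by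
      simp [v]
    rw [this, smul_smul, ← Complex.ofReal_mul, mul_inv_cancel₀ (norm_ne_zero_iff.2 h)]
    simp

lemma svd_gen {E F : Type*} [NormedAddCommGroup E] [InnerProductSpace ℂ E] [FiniteDimensional ℂ E]
    [NormedAddCommGroup F] [InnerProductSpace ℂ F] [FiniteDimensional ℂ F] {r s : ℕ}
    (hE : Module.finrank ℂ E = r) (hF : Module.finrank ℂ F = s) (A : F →ₗ[ℂ] E) :
    ∃ (e : OrthonormalBasis (Fin r) ℂ E) (f : OrthonormalBasis (Fin s) ℂ F) (k : ℕ → ℝ),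
      ∀ j : Fin s, A (f j) = if h : (j : ℕ) < r then (k j : ℂ) • e ⟨j, h⟩ else 0 := by
  rcases le_total s r with h | h
  · obtain ⟨e, f, k, hk⟩ := svd_aux hE hF h A
    refine ⟨e, f, fun j => if h : j < s then k ⟨j, h⟩ else 0, fun j => ?_⟩
    rw [hk, dif_pos (j.2.trans_le h)]
    simp
    rfl
  · obtain ⟨f, e, k, hk⟩ := svd_aux hF hE h (LinearMap.adjoint A)
    refine ⟨e, f, fun j => if h : j < r then k ⟨j, h⟩ else 0, fun j => ?_⟩
    have key : ∀ i, inner ℂ (e i) (A (f j)) = if Fin.castLE h i = j then (k i : ℂ) else 0 := by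
      intro i
      rw [← LinearMap.adjoint_inner_left, hk, inner_smul_left,
        orthonormal_iff_ite.1 f.orthonormal]
      simp
    rw [← e.sum_repr' (A (f j))]
    simp only [key]
    split_ifs with hj
    · rw [Finset.sum_eq_single ⟨j, hj⟩]
      · simp
      · intro b _ hb
        rw [if_neg, zero_smul]
        intro hh
        apply hb
        subst hh
        rfl
      · simp
    · apply Finset.sum_eq_zero
      intro i _
      rw [if_neg, zero_smul]
      intro hh
      apply hj
      rw [← hh]
      simp

/-- the permutation underlying `Tmat`. -/
def sigT (n ν : ℕ) (h : 2 * ν ≤ n) (i : Fin n) : Fin n :=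
  if h1 : (i : ℕ) < ν then ⟨n - ν + i, by omega⟩
  else if h2 : (i : ℕ) < n - ν then i else ⟨i - (n - ν), by omega⟩

/-- the signs of `Tmat`. -/
noncomputable def cT (n ν : ℕ) (ε : ℝ) (i : Fin n) : ℝ :=
  if (i : ℕ) < ν then 1 else if (i : ℕ) < n - ν then ε else 1

lemma sigT_val (n ν : ℕ) (h : 2 * ν ≤ n) (i : Fin n) : (sigT n ν h i : ℕ) =
    if (i : ℕ) < ν then n - ν + i else if (i : ℕ) < n - ν then i else i - (n - ν) := by
  unfold sigT
  split_ifs <;> rfl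

lemma sigT_sigT (n ν : ℕ) (h : 2 * ν ≤ n) (i : Fin n) : sigT n ν h (sigT n ν h i) = i := by
  have := i.2
  ext
  simp only [sigT_val]
  split_ifs <;> omega

lemma cT_sigT (n ν : ℕ) (h : 2 * ν ≤ n) (ε : ℝ) (i : Fin n) :
    cT n ν ε (sigT n ν h i) = cT n ν ε i := by
  have := i.2
  simp only [cT, sigT_val]
  split_ifs <;> first | rfl | omega

lemma Tmat_apply (n ν : ℕ) (h : 2 * ν ≤ n) (ε : ℝ) (i j : Fin n) :
    Tmat n ν ε i j = if j = sigT n ν h i then cT n ν ε i else 0 := by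
  have := i.2
  have := j.2
  simp only [Tmat, Matrix.of_apply, Fin.ext_iff, sigT_val, cT]
  split_ifs <;> first | rfl | omega

lemma Tmat_symm (n ν : ℕ) (h : 2 * ν ≤ n) (ε : ℝ) (i j : Fin n) :
    Tmat n ν ε i j = Tmat n ν ε j i := by
  rw [Tmat_apply n ν h, Tmat_apply n ν h]
  by_cases hj : j = sigT n ν h i
  · subst hj
    simp [sigT_sigT, cT_sigT]
  · rw [if_neg hj, if_neg]
    rintro rfl
    exact hj (sigT_sigT n ν h j).symm

lemma Tmat_sq (n ν : ℕ) (h : 2 * ν ≤ n) (ε : ℝ) (hε : ε * ε = 1) :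
    Tmat n ν ε * Tmat n ν ε = 1 := by
  ext i j
  simp only [Matrix.mul_apply, Tmat_apply n ν h]
  simp only [ite_mul, zero_mul, Finset.sum_ite_eq', Finset.sum_ite_eq, Finset.mem_univ, if_true, sigT_sigT, cT_sigT,
    Matrix.one_apply]
  have : cT n ν ε i * cT n ν ε i = 1 := by
    unfold cT
    split_ifs <;> simp [hε]
  by_cases hij : j = i
  · simp [hij, this]
  · simp [hij, Ne.symm hij]

/-- Assemble the factorization from an orthonormal family. -/
lemma assemble {n ν : ℕ} (h : 2 * ν ≤ n) (ε : ℝ) (B : Matrix (Fin n) (Fin n) ℂ)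
    (u : Fin n → EuclideanSpace ℂ (Fin n)) (hu : Orthonormal ℂ u) (Sv : Fin n → ℝ)
    (hB : ∀ j, Matrix.toEuclideanLin B (u j) =
      ((Sv (sigT n ν h j) * cT n ν ε j : ℝ) : ℂ) • u (sigT n ν h j)) :
    ∃ U ∈ Matrix.unitaryGroup (Fin n) ℂ, B = U * Matrix.diagonal (fun i => (Sv i : ℂ)) *
              (U * (Tmat n ν ε).map Complex.ofReal)ᴴ := by
  let U : Matrix (Fin n) (Fin n) ℂ := Matrix.of fun i j => u j i
  have hU : Uᴴ * U = 1 := by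
    ext i j
    have := orthonormal_iff_ite.1 hu i j
    rw [Matrix.one_apply, ← this]
    simp [Matrix.mul_apply, U, PiLp.inner_apply, mul_comm]
  have hU' : U * Uᴴ = 1 := mul_eq_one_comm.1 hU
  refine ⟨U, Matrix.mem_unitaryGroup_iff.2 hU', ?_⟩
  have hT : ((Tmat n ν ε).map Complex.ofReal)ᴴ = (Tmat n ν ε).map Complex.ofReal := by
    ext i j
    simp [Matrix.conjTranspose_apply, Tmat_symm n ν h ε j i]
  have key : B * U = U * Matrix.diagonal (fun i => (Sv i : ℂ)) * (Tmat n ν ε).map Complex.ofReal := by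
    ext i j
    have h1 : (B * U) i j = (Matrix.toEuclideanLin B (u j)) i := by
      simp [Matrix.mul_apply, U, Matrix.toLpLin_apply, Matrix.mulVec, dotProduct]
    rw [h1, hB, Matrix.mul_apply]
    simp only [Matrix.mul_diagonal, Matrix.map_apply, Tmat_symm n ν h ε _ j, Tmat_apply n ν h]
    rw [Finset.sum_eq_single (sigT n ν h j)]
    · simp [U]
      ring
    · intro b _ hb
      simp [hb]
    · simp
  rw [Matrix.conjTranspose_mul, hT, ← Matrix.mul_assoc, ← key, Matrix.mul_assoc, hU', Matrix.mul_one]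

/-- Adapted orthonormal families, extended by zero to all of `ℕ`. -/
lemma families {n : ℕ} (M : Matrix (Fin n) (Fin n) ℂ) (hM : M * M = M)
    (r s : ℕ) (hr : r = M.rank) (hs : s = n - r) :
    ∃ (e f : ℕ → EuclideanSpace ℂ (Fin n)) (k : ℕ → ℝ),
      (∀ i j, inner ℂ (e i) (e j) = if i = j ∧ i < r then (1 : ℂ) else 0) ∧
      (∀ i j, inner ℂ (f i) (f j) = if i = j ∧ i < s then (1 : ℂ) else 0) ∧
      (∀ i j, inner ℂ (e i) (f j) = (0 : ℂ)) ∧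
      (∀ i, r ≤ i → e i = 0) ∧ (∀ i, s ≤ i → f i = 0) ∧
      (∀ i, Matrix.toEuclideanLin M (e i) = e i) ∧
      (∀ i, Matrix.toEuclideanLin M (f i) = (k i : ℂ) • e i) := by
  set L := Matrix.toEuclideanLin M with hL
  have hLL : ∀ x, L (L x) = L x := by
    intro x
    simp [hL, Matrix.toLpLin_apply, Matrix.mulVec_mulVec, hM]
  let E := LinearMap.range L
  have hE : Module.finrank ℂ E = r := by
    rw [hr, Matrix.rank_eq_finrank_range_toLin M (EuclideanSpace.basisFun (Fin n) ℂ).toBasis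
      (EuclideanSpace.basisFun (Fin n) ℂ).toBasis]
    rfl
  have hF : Module.finrank ℂ Eᗮ = s := by
    have := Submodule.finrank_add_finrank_orthogonal E
    rw [hE, finrank_euclideanSpace_fin] at this
    omega
  let A : Eᗮ →ₗ[ℂ] E := L.rangeRestrict ∘ₗ Eᗮ.subtype
  obtain ⟨e, f, k, hk⟩ := svd_gen (E := E) (F := Eᗮ) hE hF A
  refine ⟨fun i => if h : i < r then (e ⟨i, h⟩ : EuclideanSpace ℂ (Fin n)) else 0,
    fun i => if h : i < s then (f ⟨i, h⟩ : EuclideanSpace ℂ (Fin n)) else 0,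
    fun i => if i < s then k i else 0, ?_, ?_, ?_, ?_, ?_, ?_, ?_⟩
  · intro i j
    by_cases hi : i < r
    · by_cases hj : j < r
      · have := orthonormal_iff_ite.1 e.orthonormal ⟨i, hi⟩ ⟨j, hj⟩
        simp only [Submodule.coe_inner, Fin.mk.injEq] at this
        simp [hi, hj, this]
      · have : i ≠ j := by omega
        simp [hj, this]
    · simp [hi]
  · intro i j
    by_cases hi : i < s
    · by_cases hj : j < s
      · have := orthonormal_iff_ite.1 f.orthonormal ⟨i, hi⟩ ⟨j, hj⟩
        simp only [Submodule.coe_inner, Fin.mk.injEq] at this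
        simp [hi, hj, this]
      · have : i ≠ j := by omega
        simp [hj, this]
    · simp [hi]
  · intro i j
    by_cases hi : i < r
    · by_cases hj : j < s
      · simp only [hi, hj, dif_pos]
        exact Submodule.inner_right_of_mem_orthogonal (e ⟨i, hi⟩).2 (f ⟨j, hj⟩).2
      · simp [hj]
    · simp [hi]
  · intro i hi
    simp [not_lt.2 hi]
  · intro i hi
    simp [not_lt.2 hi]
  · intro i
    by_cases hi : i < r
    · simp only [hi, dif_pos]
      obtain ⟨x, hx⟩ := (e ⟨i, hi⟩).2
      rw [← hx, hLL]
    · simp [hi]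
  · intro i
    by_cases hi : i < s
    · have := congrArg (Subtype.val) (hk ⟨i, hi⟩)
      simp only [hi, dif_pos, if_true]
      refine Eq.trans this ?_
      by_cases hi' : i < r
      · simp [hi']
      · simp [hi']
    · simp [hi]

lemma main_aux {n : ℕ}
    (M : Matrix (Fin n) (Fin n) ℂ) (hM : M * M = M)
    (r s ν : ℕ) (hr : r = M.rank) (hs : s = n - r) (hν : ν = min r s) (h : 2 * ν ≤ n)
    (B : Matrix (Fin n) (Fin n) ℂ) (hB : B = 2 • M - 1)
    (ε : ℝ) (hε : ε = if r ≤ s then -1 else 1) :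
    ∃ (u : Fin n → EuclideanSpace ℂ (Fin n)) (Sv : Fin n → ℝ), Orthonormal ℂ u ∧
      (∀ i, 0 ≤ Sv i) ∧ ∀ j, Matrix.toEuclideanLin B (u j) =
      ((Sv (sigT n ν h j) * cT n ν ε j : ℝ) : ℂ) • u (sigT n ν h j) := by
  have hrn : r ≤ n := by
    rw [hr]
    simpa using M.rank_le_width
  obtain ⟨e, f, k, hee, hff, hef, he0, hf0, hMe, hMf⟩ := families M hM r s hr hs
  have hfe : ∀ i j, inner ℂ (f i) (e j) = (0 : ℂ) := by
    intro i j
    rw [← inner_conj_symm, hef, map_zero]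
  have hBL : ∀ x, Matrix.toEuclideanLin B x = (2 : ℂ) • Matrix.toEuclideanLin M x - x := by
    intro x
    subst hB
    rw [two_smul ℕ, two_smul ℂ]
    simp
  have ht : ∀ i, ∃ t d : ℝ, 0 < t ∧ t * (t + 2 * k i) = 1 ∧ d * d * (1 + t * t) = 1 := by
    intro i
    have h1 : Real.sqrt (k i ^ 2 + 1) ^ 2 = k i ^ 2 + 1 := Real.sq_sqrt (by positivity)
    have h2 : 0 < -k i + Real.sqrt (k i ^ 2 + 1) := by
      have : |k i| < Real.sqrt (k i ^ 2 + 1) := by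
        rw [← Real.sqrt_sq_eq_abs]
        exact Real.sqrt_lt_sqrt (by positivity) (by linarith)
      have := le_abs_self (k i)
      linarith
    refine ⟨_, (Real.sqrt (1 + (-k i + Real.sqrt (k i ^ 2 + 1)) ^ 2))⁻¹, h2, by nlinarith, ?_⟩
    have h3 : 0 < 1 + (-k i + Real.sqrt (k i ^ 2 + 1)) ^ 2 := by positivity
    rw [← mul_inv, Real.mul_self_sqrt h3.le, ← pow_two]
    exact inv_mul_cancel₀ h3.ne'
  choose t d ht0 htk hd using ht
  have htkc : ∀ i, (t i : ℂ) * (t i + 2 * k i) = 1 := fun i => by exact_mod_cast htk i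
  have hdc : ∀ i, (d i : ℂ) * d i * (1 + t i * t i) = 1 := fun i => by exact_mod_cast hd i
  let a : ℕ → EuclideanSpace ℂ (Fin n) := fun i => (d i : ℂ) • ((t i : ℂ) • e i + f i)
  let b : ℕ → EuclideanSpace ℂ (Fin n) := fun i => (d i : ℂ) • (e i - (t i : ℂ) • f i)
  have hBa : ∀ i, Matrix.toEuclideanLin B (a i) = ((t i)⁻¹ : ℂ) • b i := by
    intro i
    have h0 : (t i : ℂ) ≠ 0 := by exact_mod_cast (ht0 i).ne'
    have h1 : (t i : ℂ)⁻¹ = t i + 2 * k i := by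
      exact inv_eq_of_mul_eq_one_right (htkc i)
    have h2 : (t i : ℂ)⁻¹ * t i = 1 := inv_mul_cancel₀ h0
    simp only [hBL, a, b, map_smul, map_add, hMe, hMf]
    rw [h1] at h2 ⊢
    linear_combination (norm := module) (d i : ℂ) • h2 • (f i)
  have hBb : ∀ i, Matrix.toEuclideanLin B (b i) = (t i : ℂ) • a i := by
    intro i
    simp only [hBL, a, b, map_smul, map_sub, hMe, hMf]
    linear_combination (norm := module) (-(d i : ℂ)) • (htkc i) • (e i)
  let u : Fin n → EuclideanSpace ℂ (Fin n) := fun i =>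
    if (i : ℕ) < ν then a i else if (i : ℕ) < n - ν then e i + f i else b (i - (n - ν))
  let Sv : Fin n → ℝ := fun i =>
    if (i : ℕ) < ν then t i else if (i : ℕ) < n - ν then 1 else (t (i - (n - ν)))⁻¹
  have haa : ∀ i j, i < ν → j < ν → inner ℂ (a i) (a j) = if i = j then (1 : ℂ) else 0 := by
    intro i j hi hj
    have h1 : i < r := by omega
    have h2 : i < s := by omega
    simp only [a, inner_add_left, inner_add_right, inner_smul_left, inner_smul_right, hee, hff,
      hef, hfe, h1, h2, and_true, Complex.conj_ofReal]
    split_ifs with hij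
    · subst hij
      linear_combination hdc i
    · ring
  have hbb : ∀ i j, i < ν → j < ν → inner ℂ (b i) (b j) = if i = j then (1 : ℂ) else 0 := by
    intro i j hi hj
    have h1 : i < r := by omega
    have h2 : i < s := by omega
    simp only [b, inner_sub_left, inner_sub_right, inner_smul_left, inner_smul_right, hee, hff,
      hef, hfe, h1, h2, and_true, Complex.conj_ofReal]
    split_ifs with hij
    · subst hij
      linear_combination hdc i
    · ring
  have hab : ∀ i j, i < ν → j < ν → inner ℂ (a i) (b j) = (0 : ℂ) := by
    intro i j hi hj
    have h1 : i < r := by omega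
    have h2 : i < s := by omega
    simp only [a, b, inner_add_left, inner_sub_right, inner_smul_left, inner_smul_right, hee, hff,
      hef, hfe, h1, h2, and_true, Complex.conj_ofReal]
    split_ifs with hij
    · subst hij
      ring
    · ring
  have hba : ∀ i j, i < ν → j < ν → inner ℂ (b i) (a j) = (0 : ℂ) := by
    intro i j hi hj
    rw [← inner_conj_symm, hab j i hj hi, map_zero]
  have hmm : ∀ i j, ν ≤ i → i < n - ν →
      inner ℂ (e i + f i) (e j + f j) = if i = j then (1 : ℂ) else 0 := by
    intro i j h1 h2
    simp only [inner_add_left, inner_add_right, hee, hff, hef, hfe]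
    by_cases hij : i = j
    · rcases le_total r s with h3 | h3
      · have h4 : ¬ i < r := by omega
        have h5 : i < s := by omega
        simp [hij ▸ h4, hij ▸ h5, hij]
      · have h4 : ¬ i < s := by omega
        have h5 : i < r := by omega
        simp [hij ▸ h4, hij ▸ h5, hij]
    · simp [hij]
  have ham : ∀ i j, i < ν → ν ≤ j → inner ℂ (a i) (e j + f j) = (0 : ℂ) := by
    intro i j h1 h2
    have : i ≠ j := by omega
    simp [a, inner_add_left, inner_add_right, inner_smul_left, hee, hff, hef, hfe, this]
  have hbm : ∀ i j, i < ν → ν ≤ j → inner ℂ (b i) (e j + f j) = (0 : ℂ) := by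
    intro i j h1 h2
    have : i ≠ j := by omega
    simp [b, inner_sub_left, inner_add_right, inner_smul_left, hee, hff, hef, hfe, this]
  have hma : ∀ i j, i < ν → ν ≤ j → inner ℂ (e j + f j) (a i) = (0 : ℂ) := by
    intro i j hi hj
    rw [← inner_conj_symm, ham i j hi hj, map_zero]
  have hmb : ∀ i j, i < ν → ν ≤ j → inner ℂ (e j + f j) (b i) = (0 : ℂ) := by
    intro i j hi hj
    rw [← inner_conj_symm, hbm i j hi hj, map_zero]
  refine ⟨u, Sv, ?_, ?_, ?_⟩
  · rw [orthonormal_iff_ite]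
    intro i j
    have := i.2
    have := j.2
    simp only [u, Fin.ext_iff]
    by_cases i1 : (i : ℕ) < ν
    · by_cases j1 : (j : ℕ) < ν
      · simp only [i1, j1, if_true, haa _ _ i1 j1]
      · have hij : (i : ℕ) ≠ j := by omega
        by_cases j2 : (j : ℕ) < n - ν
        · simp only [i1, j1, j2, if_true, if_false, ham _ _ i1 (not_lt.1 j1), hij]
        · simp only [i1, j1, j2, if_true, if_false, hij]
          exact hab _ _ i1 (by omega)
    · by_cases i2 : (i : ℕ) < n - ν
      · by_cases j1 : (j : ℕ) < ν
        · have hij : (i : ℕ) ≠ j := by omega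
          simp only [i1, i2, j1, if_true, if_false, hij]
          exact hma _ _ j1 (by omega)
        · by_cases j2 : (j : ℕ) < n - ν
          · simp only [i1, i2, j1, j2, if_true, if_false]
            exact hmm _ _ (by omega) i2
          · have hij : (i : ℕ) ≠ j := by omega
            simp only [i1, i2, j1, j2, if_true, if_false, hij]
            exact hmb _ _ (by omega) (by omega)
      · by_cases j1 : (j : ℕ) < ν
        · have hij : (i : ℕ) ≠ j := by omega
          simp only [i1, i2, j1, if_true, if_false, hij]
          exact hba _ _ (by omega) j1
        · by_cases j2 : (j : ℕ) < n - ν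
          · have hij : (i : ℕ) ≠ j := by omega
            simp only [i1, i2, j1, j2, if_true, if_false, hij]
            exact hbm _ _ (by omega) (by omega)
          · simp only [i1, i2, j1, j2, if_false]
            rw [hbb _ _ (by omega) (by omega)]
            congr 1
            simp only [eq_iff_iff]
            omega
  · intro i
    simp only [Sv]
    split_ifs
    · exact (ht0 _).le
    · exact zero_le_one
    · exact (inv_pos.2 (ht0 _)).le
  · intro j
    have := j.2
    simp only [u, Sv, cT, sigT_val]
    by_cases j1 : (j : ℕ) < ν
    · have h1 : ¬ (n - ν + (j : ℕ) < ν) := by omega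
      have h2 : ¬ (n - ν + (j : ℕ) < n - ν) := by omega
      simp only [j1, h1, h2, if_true, if_false, hBa, Nat.add_sub_cancel_left]
      simp
    · by_cases j2 : (j : ℕ) < n - ν
      · simp only [j1, j2, if_true, if_false, one_mul]
        simp only [hBL, map_add, hMe, hMf]
        rcases le_or_gt r s with h3 | h3
        · rw [he0 j (by omega), hε, if_pos h3]
          simp
        · rw [hf0 j (by omega), hε, if_neg (by omega)]
          have : (k j : ℂ) • e j = 0 := by
            rw [← hMf, hf0 j (by omega), map_zero]
          rw [this]
          simp [two_smul]
      · have h1 : (j : ℕ) - (n - ν) < ν := by omega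
        simp only [j1, j2, h1, if_true, if_false, hBb, mul_one]

theorem svd_involutory_signed_permutation {n : ℕ}
    (M : Matrix (Fin n) (Fin n) ℂ) (hM : M * M = M)
    (r s ν : ℕ) (hr : r = M.rank) (hs : s = n - r) (hν : ν = min r s)
    (B : Matrix (Fin n) (Fin n) ℂ) (hB : B = 2 • M - 1)
    (ε : ℝ) (hε : ε = if r ≤ s then -1 else 1) :
    Tmat n ν ε ∈ Matrix.orthogonalGroup (Fin n) ℝ ∧
      Tmat n ν ε * Tmat n ν ε = 1 ∧
      ∃ (Utilde : Matrix (Fin n) (Fin n) ℂ) (Sv : Fin n → ℝ),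
        Utilde ∈ Matrix.unitaryGroup (Fin n) ℂ ∧
        (∀ i, 0 ≤ Sv i) ∧
        B = Utilde * Matrix.diagonal (fun i => (Sv i : ℂ)) *
              (Utilde * (Tmat n ν ε).map Complex.ofReal)ᴴ := by
  have hrn : r ≤ n := by
    rw [hr]
    simpa using M.rank_le_width
  have h : 2 * ν ≤ n := by omega
  have hsq : Tmat n ν ε * Tmat n ν ε = 1 := by
    apply Tmat_sq n ν h
    rw [hε]
    split_ifs <;> norm_num
  refine ⟨?_, hsq, ?_⟩
  · rw [Matrix.mem_orthogonalGroup_iff]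
    have : (Tmat n ν ε)ᵀ = Tmat n ν ε := by
      ext i j
      simp [Matrix.transpose_apply, Tmat_symm n ν h ε j i]
    rw [this, hsq]
  · obtain ⟨u, Sv, hu, hS, hBu⟩ := main_aux M hM r s ν hr hs hν h B hB ε hε
    obtain ⟨U, hU, hBU⟩ := assemble h ε B u hu Sv hBu
    exact ⟨U, Sv, hU, hS, hBU⟩
end
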